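/- Let T be a polyhedral element, fix a face f_j with unit normal n_j, let t₁, t₂ be orthonormal tangent vectors of the plane of f_j, and let π_j denote the orthogonal projection of ℝ³ onto the plane of f_j. Let k ≥ 0 be an integer, let v₀ ∈ [P_k(T)]³, and let v_b = v₁t₁ + v₂t₂ where v₁, v₂ are polynomials of total degree at most k on the plane of f_j. Define q : T → ℝ³ by q(X) = ((v_b − v₀) × n_j)(π_j(X)) · l_j(X) · φ_{f_j}(X), where (v_b − v₀) × n_j is evaluated at the projected point π_j(X). Then there exists a constant C, depending only on T and k, such that ‖q‖²_{L²(T)} ≤ C h_T ∫_{f_j} |(v_b − v₀) × n_j|² dS. -/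

import Mathlib

open MeasureTheory

noncomputable section

/-- `ℝ³` as a Euclidean space. -/
abbrev E3 : Type := EuclideanSpace ℝ (Fin 3)

/-- The Euclidean dot product on `ℝ³`. -/
def dot3 (a b : E3) : ℝ := ∑ i : Fin 3, a i * b i

/-- The cross product on `ℝ³`. -/
def cross3 (a b : E3) : E3 :=
  (EuclideanSpace.equiv (Fin 3) ℝ).symm
    ![a 1 * b 2 - a 2 * b 1, a 2 * b 0 - a 0 * b 2, a 0 * b 1 - a 1 * b 0]

/-- Partial derivative in the `i`-th coordinate direction. -/
def pd (i : Fin 3) (f : E3 → ℝ) (x : E3) : ℝ := fderiv ℝ f x (EuclideanSpace.single i 1)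

/-- The gradient of a scalar field on `ℝ³`. -/
def grad3 (f : E3 → ℝ) (x : E3) : E3 :=
  (EuclideanSpace.equiv (Fin 3) ℝ).symm ![pd 0 f x, pd 1 f x, pd 2 f x]

/-- The divergence of a vector field on `ℝ³`. -/
def div3 (v : E3 → E3) (x : E3) : ℝ := ∑ i : Fin 3, pd i (fun y => v y i) x

/-- The curl of a vector field on `ℝ³`. -/
def curl3 (v : E3 → E3) (x : E3) : E3 :=
  (EuclideanSpace.equiv (Fin 3) ℝ).symm
    ![pd 1 (fun y => v y 2) x - pd 2 (fun y => v y 1) x,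
      pd 2 (fun y => v y 0) x - pd 0 (fun y => v y 2) x,
      pd 0 (fun y => v y 1) x - pd 1 (fun y => v y 0) x]

/-- The curl-curl operator `(∇×)²`. -/
def curlcurl3 (v : E3 → E3) : E3 → E3 := curl3 (curl3 v)

/-- `f : ℝ³ → ℝ` is (globally) a real polynomial of total degree at most `k`. -/
def PolyFun (k : ℕ) (f : E3 → ℝ) : Prop :=
  ∃ p : MvPolynomial (Fin 3) ℝ, p.totalDegree ≤ k ∧
    ∀ x : E3, f x = MvPolynomial.eval (fun i => x i) p

/-- `v : ℝ³ → ℝ³` is componentwise a polynomial of total degree at most `k`. -/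
def PolyVec (k : ℕ) (v : E3 → E3) : Prop := ∀ c : Fin 3, PolyFun k (fun x => v x c)

/-- A (possibly non-convex) polyhedral element in `ℝ³`: a nonempty bounded open set whose
boundary is the union of `N` planar compact faces of positive two-dimensional Hausdorff
measure, with outward unit normals. -/
structure PolyhedralElement (N : ℕ) where
  carrier : Set E3
  face : Fin N → Set E3
  normal : Fin N → E3
  basept : Fin N → E3
  carrier_nonempty : carrier.Nonempty
  carrier_isOpen : IsOpen carrier
  carrier_isBounded : Bornology.IsBounded carrier
  frontier_eq : frontier carrier = ⋃ i, face i
  face_isCompact : ∀ i, IsCompact (face i)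
  face_pos : ∀ i, 0 < μH[(2 : ℝ)] (face i)
  face_inter_null : ∀ i j, i ≠ j → μH[(2 : ℝ)] (face i ∩ face j) = 0
  normal_unit : ∀ i, ‖normal i‖ = 1
  basept_mem : ∀ i, basept i ∈ face i
  face_planar : ∀ i, ∀ x ∈ face i, dot3 (x - basept i) (normal i) = 0
  normal_outward : ∀ i, ∀ x ∈ face i, (∀ j, j ≠ i → x ∉ face j) →
    ∃ ε > (0 : ℝ), ∀ t : ℝ, 0 < t → t < ε →
      x + t • normal i ∉ carrier ∧ x - t • normal i ∈ carrier

namespace PolyhedralElement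

variable {N : ℕ} (P : PolyhedralElement N)

/-- The element size `h_T = diam T`. -/
def hT : ℝ := Metric.diam P.carrier

/-- The affine function `l_i(x) = (x − A_i)·n_i / h_T`, vanishing on face `f_i`. -/
def lfun (i : Fin N) (x : E3) : ℝ := dot3 (x - P.basept i) (P.normal i) / P.hT

/-- The element bubble function `Φ_B = l₁² ⋯ l_N²`. -/
def bubble (x : E3) : ℝ := ∏ i, (P.lfun i x) ^ 2

/-- The face bubble function `φ_{f_j} = ∏_{i ≠ j} l_i²`. -/
def faceBubble (j : Fin N) (x : E3) : ℝ := ∏ i ∈ Finset.univ.erase j, (P.lfun i x) ^ 2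

/-- Orthogonal projection of `ℝ³` onto the plane of face `f_j`. -/
def faceProj (j : Fin N) (x : E3) : E3 :=
  x - dot3 (x - P.basept j) (P.normal j) • P.normal j

/-- `nv` is (a version of) the outward unit normal field on `∂T`: on the boundary it always
equals one of the face normals, and at every point lying on exactly one face it equals the
outward normal of that face. -/
def IsOutwardNormal (nv : E3 → E3) : Prop :=
  Measurable nv ∧
  (∀ x ∈ frontier P.carrier, ∃ i, x ∈ P.face i ∧ nv x = P.normal i) ∧
  (∀ i, ∀ x ∈ P.face i, (∀ j, j ≠ i → x ∉ P.face j) → nv x = P.normal i)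

/-- `G` is the discrete weak gradient `∇_{w,r,T}{σ₀, σ_b}`. -/
def IsWeakGradient (r : ℕ) (nv : E3 → E3) (σ₀ σb : E3 → ℝ) (G : E3 → E3) : Prop :=
  PolyVec r G ∧
  ∀ ψ : E3 → E3, PolyVec r ψ →
    (∫ x in P.carrier, dot3 (G x) (ψ x)) =
      -(∫ x in P.carrier, σ₀ x * div3 ψ x) +
      ∫ x in frontier P.carrier, σb x * dot3 (ψ x) (nv x) ∂(μH[(2 : ℝ)])

/-- `G` is the discrete weak curl-curl `(∇×)²_{w,r,T}{v₀, v_b, v_n}`. -/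
def IsWeakCurlCurl (r : ℕ) (nv : E3 → E3) (v₀ vb vn : E3 → E3) (G : E3 → E3) : Prop :=
  PolyVec r G ∧
  ∀ q : E3 → E3, PolyVec r q →
    (∫ x in P.carrier, dot3 (G x) (q x)) =
      (∫ x in P.carrier, dot3 (v₀ x) (curlcurl3 q x))
      - (∫ x in frontier P.carrier, dot3 (cross3 (vb x) (nv x)) (curl3 q x) ∂(μH[(2 : ℝ)]))
      - ∫ x in frontier P.carrier, dot3 (cross3 (vn x) (nv x)) (q x) ∂(μH[(2 : ℝ)])

end PolyhedralElement

theorem exists_norm_le_of_ker_le {V F G : Type*} [AddCommGroup V] [Module ℝ V]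
    [FiniteDimensional ℝ V] [NormedAddCommGroup F] [NormedSpace ℝ F] [NormedAddCommGroup G]
    [NormedSpace ℝ G] (A : V →ₗ[ℝ] F) (B : V →ₗ[ℝ] G)
    (h : LinearMap.ker B ≤ LinearMap.ker A) : ∃ C : ℝ, ∀ v, ‖A v‖ ≤ C * ‖B v‖ := by
  have hker : LinearMap.ker B.rangeRestrict ≤ LinearMap.ker A := by
    rwa [LinearMap.ker_rangeRestrict]
  obtain ⟨g, hg⟩ := LinearMap.exists_rightInverse_of_surjective B.rangeRestrict
    B.range_rangeRestrict
  refine ⟨‖LinearMap.toContinuousLinearMap (A ∘ₗ g)‖, fun v => ?_⟩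
  have hv : A v = LinearMap.toContinuousLinearMap (A ∘ₗ g) (B.rangeRestrict v) := by
    have hmem : v - g (B.rangeRestrict v) ∈ LinearMap.ker B.rangeRestrict := by
      have := LinearMap.congr_fun hg (B.rangeRestrict v)
      simp only [LinearMap.comp_apply, LinearMap.id_apply] at this
      rw [LinearMap.mem_ker, map_sub, this, sub_self]
    have := hker hmem
    rw [LinearMap.mem_ker, map_sub, sub_eq_zero] at this
    simpa using this
  rw [hv]
  exact (LinearMap.toContinuousLinearMap (A ∘ₗ g)).le_opNorm _

theorem integral_norm_sq_eq_norm_toLp_sq {X F : Type*} [MeasurableSpace X] [NormedAddCommGroup F]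
    [InnerProductSpace ℝ F] {μ : Measure X} {f : X → F} (hf : MemLp f 2 μ) :
    ∫ x, ‖f x‖ ^ 2 ∂μ = ‖hf.toLp f‖ ^ 2 := by
  rw [← real_inner_self_eq_norm_sq, L2.inner_def]
  refine integral_congr_ae ?_
  filter_upwards [hf.coeFn_toLp] with x hx
  rw [hx, real_inner_self_eq_norm_sq]

/-- A linear family of square-integrable functions, as a linear map into `L²`. -/
def toL2 {V X F : Type*} [AddCommGroup V] [Module ℝ V] [MeasurableSpace X]
    [NormedAddCommGroup F] [InnerProductSpace ℝ F] {μ : Measure X} (A : V →ₗ[ℝ] (X → F))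
    (hA : ∀ v, MemLp (A v) 2 μ) : V →ₗ[ℝ] Lp F 2 μ where
  toFun v := (hA v).toLp (A v)
  map_add' v w := by
    rw [← MemLp.toLp_add]
    exact MemLp.toLp_congr _ _ (by rw [map_add])
  map_smul' c v := by
    rw [RingHom.id_apply, ← MemLp.toLp_const_smul]
    exact MemLp.toLp_congr _ _ (by rw [map_smul])

theorem exists_integral_norm_sq_le {V X F : Type*} [AddCommGroup V] [Module ℝ V]
    [FiniteDimensional ℝ V] [MeasurableSpace X] [NormedAddCommGroup F] [InnerProductSpace ℝ F]
    {μ ν : Measure X} (A B : V →ₗ[ℝ] (X → F)) (hA : ∀ v, MemLp (A v) 2 μ)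
    (hB : ∀ v, MemLp (B v) 2 ν) (h : ∀ v, B v =ᵐ[ν] 0 → A v =ᵐ[μ] 0) :
    ∃ C : ℝ, ∀ v, ∫ x, ‖A v x‖ ^ 2 ∂μ ≤ C * ∫ x, ‖B v x‖ ^ 2 ∂ν := by
  obtain ⟨C, hC⟩ := exists_norm_le_of_ker_le (toL2 A hA) (toL2 B hB) fun v hv => by
    rw [LinearMap.mem_ker] at hv ⊢
    exact (MemLp.toLp_eq_toLp_iff (hA v) MemLp.zero).2
      (h v ((MemLp.toLp_eq_toLp_iff (hB v) MemLp.zero).1 hv))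
  refine ⟨C ^ 2, fun v => ?_⟩
  rw [integral_norm_sq_eq_norm_toLp_sq (hA v), integral_norm_sq_eq_norm_toLp_sq (hB v), ← mul_pow]
  exact pow_le_pow_left₀ (norm_nonneg _) (hC v) 2

theorem volume_zero_set_eq_zero_of_polynomial {f : ℝ × ℝ → ℝ} (hf : Continuous f)
    (hl : ∀ t, ∃ p : Polynomial ℝ, ∀ s, f (s, t) = p.eval s)
    (hr : ∀ s, ∃ p : Polynomial ℝ, ∀ t, f (s, t) = p.eval t)
    {z : ℝ × ℝ} (hz : f z ≠ 0) : volume {x | f x = 0} = 0 := by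
  have hfin {g : ℝ → ℝ} (hg : ∃ p : Polynomial ℝ, ∀ s, g s = p.eval s) {a : ℝ} (ha : g a ≠ 0) :
      volume {s | g s = 0} = 0 := by
    obtain ⟨p, hp⟩ := hg
    have hp0 : p ≠ 0 := by
      rintro rfl
      exact ha (by simp [hp])
    refine Set.Finite.measure_zero ?_ _
    simpa only [hp] using! Polynomial.finite_setOfPred_isRoot hp0
  rw [Measure.volume_eq_prod,
    Measure.measure_prod_null (isClosed_eq hf continuous_const).measurableSet]
  have h1 : ∀ᵐ s : ℝ, f (s, z.2) ≠ 0 := by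
    rw [ae_iff]
    simpa using hfin (hl z.2) (a := z.1) hz
  filter_upwards [h1] with s hs
  exact hfin (hr s) hs

theorem MvPolynomial.exists_eval_line {σ : Type*} (p : MvPolynomial σ ℝ) (a b : σ → ℝ) :
    ∃ q : Polynomial ℝ, ∀ s : ℝ, p.eval (fun i => a i + s * b i) = q.eval s := by
  refine ⟨MvPolynomial.aeval (fun i => Polynomial.C (a i) + Polynomial.X * Polynomial.C (b i)) p,
    fun s => ?_⟩
  induction p using MvPolynomial.induction_on with
  | C r => simp
  | add p q hp hq => simp [hp, hq]
  | mul_X p i hp =>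
    simp only [map_mul, hp, MvPolynomial.eval_X, Polynomial.eval_mul, MvPolynomial.aeval_X,
      Polynomial.eval_add, Polynomial.eval_C, Polynomial.eval_X]

theorem dot3_eq_inner (a b : E3) : dot3 a b = inner ℝ b a := by
  simp [dot3, PiLp.inner_apply]

theorem continuous_dot3_left (b : E3) : Continuous fun a => dot3 a b := by
  simp_rw [dot3_eq_inner]
  fun_prop

theorem eq_sum_of_orthonormal {t₁ t₂ n : E3} (ht₁ : ‖t₁‖ = 1) (ht₂ : ‖t₂‖ = 1) (hn : ‖n‖ = 1)
    (ht₁₂ : dot3 t₁ t₂ = 0) (ht₁n : dot3 t₁ n = 0) (ht₂n : dot3 t₂ n = 0) (x : E3) :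
    x = dot3 x t₁ • t₁ + dot3 x t₂ • t₂ + dot3 x n • n := by
  simp only [dot3_eq_inner] at *
  have hon : Orthonormal ℝ ![t₁, t₂, n] := by
    refine ⟨fun i => by fin_cases i <;> simp [*], fun i j hij => ?_⟩
    fin_cases i <;> fin_cases j <;> simp_all [real_inner_comm]
  have hb : ⊤ ≤ Submodule.span ℝ (Set.range ![t₁, t₂, n]) :=
    (hon.linearIndependent.span_eq_top_of_card_eq_finrank (by simp)).ge
  have := (OrthonormalBasis.mk hon hb).sum_repr' x
  simpa [Fin.sum_univ_three, eq_comm] using this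

/-- The parametrization of the plane through `A` spanned by `t₁` and `t₂`. -/
def planeMap (A t₁ t₂ : E3) (z : ℝ × ℝ) : E3 := A + (z.1 • t₁ + z.2 • t₂)

theorem lipschitzWith_planeMap (A t₁ t₂ : E3) : ∃ K, LipschitzWith K (planeMap A t₁ t₂) := by
  let L : ℝ × ℝ →L[ℝ] E3 := (ContinuousLinearMap.fst ℝ ℝ ℝ).smulRight t₁ +
    (ContinuousLinearMap.snd ℝ ℝ ℝ).smulRight t₂
  refine ⟨‖L‖₊, LipschitzWith.of_dist_le_mul fun z w => ?_⟩
  simpa [planeMap, L] using L.lipschitz.dist_le_mul z w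

theorem hausdorffMeasure_planeMap_image_ne_top (A t₁ t₂ : E3) {S : Set (ℝ × ℝ)}
    (hS : IsCompact S) : μH[2] (planeMap A t₁ t₂ '' S) ≠ ⊤ := by
  obtain ⟨K, hK⟩ := lipschitzWith_planeMap A t₁ t₂
  refine ne_top_of_le_ne_top ?_ (hK.hausdorffMeasure_image_le zero_le_two S)
  rw [hausdorffMeasure_prod_real]
  exact ENNReal.mul_ne_top (by simp) hS.measure_lt_top.ne

theorem hausdorffMeasure_planeMap_image_eq_zero (A t₁ t₂ : E3) {S : Set (ℝ × ℝ)}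
    (hS : volume S = 0) : μH[2] (planeMap A t₁ t₂ '' S) = 0 := by
  obtain ⟨K, hK⟩ := lipschitzWith_planeMap A t₁ t₂
  refine le_antisymm ((hK.hausdorffMeasure_image_le zero_le_two S).trans ?_) zero_le
  rw [hausdorffMeasure_prod_real, hS, mul_zero]

theorem PolyFun.continuous {k : ℕ} {f : E3 → ℝ} (hf : PolyFun k f) : Continuous f := by
  obtain ⟨p, -, hp⟩ := hf
  rw [funext hp]
  exact (MvPolynomial.continuous_eval p).comp (by fun_prop)

theorem PolyFun.add {k : ℕ} {f g : E3 → ℝ} (hf : PolyFun k f) (hg : PolyFun k g) :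
    PolyFun k fun x => f x + g x := by
  obtain ⟨p, hpk, hp⟩ := hf
  obtain ⟨q, hqk, hq⟩ := hg
  exact ⟨p + q, (MvPolynomial.totalDegree_add p q).trans (max_le hpk hqk), fun x => by
    simp [hp, hq]⟩

theorem PolyFun.const_mul {k : ℕ} {f : E3 → ℝ} (c : ℝ) (hf : PolyFun k f) :
    PolyFun k fun x => c * f x := by
  obtain ⟨p, hpk, hp⟩ := hf
  exact ⟨c • p, (MvPolynomial.totalDegree_smul_le c p).trans hpk, fun x => by
    simp [hp, MvPolynomial.smul_eval]⟩

theorem PolyFun.volume_planeMap_zero_set {k : ℕ} {f : E3 → ℝ} (hf : PolyFun k f) (A t₁ t₂ : E3)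
    {z : ℝ × ℝ} (hz : f (planeMap A t₁ t₂ z) ≠ 0) :
    volume {z | f (planeMap A t₁ t₂ z) = 0} = 0 := by
  obtain ⟨K, hK⟩ := lipschitzWith_planeMap A t₁ t₂
  refine volume_zero_set_eq_zero_of_polynomial (hf.continuous.comp hK.continuous)
    (fun t => ?_) (fun s => ?_) hz
  all_goals obtain ⟨p, -, hp⟩ := hf
  · obtain ⟨q, hq⟩ := p.exists_eval_line (fun i => A i + t * t₂ i) (fun i => t₁ i)
    refine ⟨q, fun s => ?_⟩
    rw [← hq, hp]
    congr 2
    ext i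
    simp [planeMap]
    ring
  · obtain ⟨q, hq⟩ := p.exists_eval_line (fun i => A i + s * t₁ i) (fun i => t₂ i)
    refine ⟨q, fun t => ?_⟩
    rw [← hq, hp]
    congr 2
    ext i
    simp [planeMap]
    ring

theorem PolyVec.continuous {k : ℕ} {v : E3 → E3} (hv : PolyVec k v) : Continuous v :=
  (PiLp.continuous_toLp 2 _).comp (continuous_pi fun c => (hv c).continuous)

theorem PolyVec.cross3_const {k : ℕ} {v : E3 → E3} (hv : PolyVec k v) (n : E3) :
    PolyVec k fun x => cross3 (v x) n := by
  have key (a b : Fin 3) (r s : ℝ) : PolyFun k fun x => v x a * r - v x b * s := by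
    convert ((hv a).const_mul r).add ((hv b).const_mul (-s)) using 2
    ring
  intro c
  fin_cases c
  · simpa [cross3] using key 1 2 _ _
  · simpa [cross3] using key 2 0 _ _
  · simpa [cross3] using key 0 1 _ _

/-- Triples of polynomials of total degree at most `k`, as vector fields. -/
def polyVecEval (k : ℕ) :
    (Fin 3 → MvPolynomial.restrictTotalDegree (Fin 3) ℝ k) →ₗ[ℝ] (E3 → E3) where
  toFun p x := WithLp.toLp 2 fun c => (p c : MvPolynomial (Fin 3) ℝ).eval fun i => x i
  map_add' p q := by
    ext x c
    simp
  map_smul' r p := by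
    ext x c
    simp [MvPolynomial.smul_eval]

theorem polyVec_polyVecEval (k : ℕ) (p) : PolyVec k (polyVecEval k p) := fun c =>
  ⟨p c, (MvPolynomial.mem_restrictTotalDegree _ _ _).1 (p c).2, fun _ => rfl⟩

theorem PolyVec.exists_polyVecEval {k : ℕ} {v : E3 → E3} (hv : PolyVec k v) :
    ∃ p, polyVecEval k p = v := by
  choose p hpk hp using hv
  refine ⟨fun c => ⟨p c, (MvPolynomial.mem_restrictTotalDegree _ _ _).2 (hpk c)⟩, ?_⟩
  ext x c
  exact (hp c x).symm

theorem memLp_restrict_of_continuous {X F : Type*} [TopologicalSpace X] [MeasurableSpace X]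
    [OpensMeasurableSpace X] [NormedAddCommGroup F] [SecondCountableTopologyEither X F]
    {μ : Measure X} {S K : Set X} (hS : μ S ≠ ⊤) (hSm : MeasurableSet S)
    (hK : IsCompact K) (hSK : S ⊆ K) {f : X → F} (hf : Continuous f) (p : ENNReal) :
    MemLp f p (μ.restrict S) := by
  obtain ⟨C, hC⟩ := hK.exists_bound_of_continuousOn hf.continuousOn
  have : IsFiniteMeasure (μ.restrict S) := ⟨by simpa using hS.lt_top⟩
  refine MemLp.of_bound hf.aestronglyMeasurable C ?_
  filter_upwards [ae_restrict_mem hSm] with x hx using hC x (hSK hx)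

namespace PolyhedralElement

variable {N : ℕ} (P : PolyhedralElement N)

theorem hT_pos : 0 < P.hT := by
  obtain ⟨x, hx⟩ := P.carrier_nonempty
  exact Metric.diam_pos (infinite_of_mem_nhds x (P.carrier_isOpen.mem_nhds hx)).nontrivial
    P.carrier_isBounded

theorem continuous_lfun (i : Fin N) : Continuous (P.lfun i) :=
  ((continuous_dot3_left _).comp (continuous_sub_right _)).div_const _

theorem continuous_faceBubble (j : Fin N) : Continuous (P.faceBubble j) :=
  continuous_finsetProd _ fun i _ => (P.continuous_lfun i).pow 2

theorem continuous_faceProj (j : Fin N) : Continuous (P.faceProj j) :=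
  continuous_id.sub
    (((continuous_dot3_left _).comp (continuous_sub_right _)).smul continuous_const)

theorem dot3_faceProj_sub (j : Fin N) (x : E3) :
    dot3 (P.faceProj j x - P.basept j) (P.normal j) = 0 := by
  have hn : inner ℝ (P.normal j) (P.normal j) = (1 : ℝ) := by
    rw [real_inner_self_eq_norm_sq, P.normal_unit, one_pow]
  simp only [faceProj, dot3_eq_inner, inner_sub_right, inner_smul_right, hn]
  ring

/-- The operator `w ↦ (w ∘ π_j) · l_j · φ_{f_j}`. -/
def bubbleExtension (j : Fin N) : (E3 → E3) →ₗ[ℝ] (E3 → E3) where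
  toFun w x := (P.lfun j x * P.faceBubble j x) • w (P.faceProj j x)
  map_add' v w := by
    ext1 x
    simp
  map_smul' c w := by
    ext1 x
    simp [smul_comm c]

theorem continuous_bubbleExtension (j : Fin N) {w : E3 → E3} (hw : Continuous w) :
    Continuous (P.bubbleExtension j w) :=
  ((P.continuous_lfun j).mul (P.continuous_faceBubble j)).smul (hw.comp (P.continuous_faceProj j))

theorem planeMap_dot3 (j : Fin N) {t₁ t₂ : E3}
    (ht₁ : ‖t₁‖ = 1) (ht₂ : ‖t₂‖ = 1) (ht₁₂ : dot3 t₁ t₂ = 0)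
    (ht₁n : dot3 t₁ (P.normal j) = 0) (ht₂n : dot3 t₂ (P.normal j) = 0)
    {x : E3} (hx : dot3 (x - P.basept j) (P.normal j) = 0) :
    planeMap (P.basept j) t₁ t₂ (dot3 (x - P.basept j) t₁, dot3 (x - P.basept j) t₂) = x := by
  have := eq_sum_of_orthonormal ht₁ ht₂ (P.normal_unit j) ht₁₂ ht₁n ht₂n (x - P.basept j)
  rw [hx, zero_smul, add_zero] at this
  rw [planeMap, ← this, add_sub_cancel]

theorem hausdorffMeasure_face_ne_top (j : Fin N) {t₁ t₂ : E3}
    (ht₁ : ‖t₁‖ = 1) (ht₂ : ‖t₂‖ = 1) (ht₁₂ : dot3 t₁ t₂ = 0)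
    (ht₁n : dot3 t₁ (P.normal j) = 0) (ht₂n : dot3 t₂ (P.normal j) = 0) :
    μH[(2 : ℝ)] (P.face j) ≠ ⊤ := by
  have hψ : Continuous fun x => (dot3 (x - P.basept j) t₁, dot3 (x - P.basept j) t₂) :=
    ((continuous_dot3_left _).comp (continuous_sub_right _)).prodMk
      ((continuous_dot3_left _).comp (continuous_sub_right _))
  refine ne_top_of_le_ne_top (hausdorffMeasure_planeMap_image_ne_top (P.basept j) t₁ t₂
    ((P.face_isCompact j).image hψ)) (measure_mono fun x hx => ?_)
  exact ⟨_, ⟨x, hx, rfl⟩, P.planeMap_dot3 j ht₁ ht₂ ht₁₂ ht₁n ht₂n (P.face_planar j x hx)⟩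

theorem eq_zero_of_ae_eq_zero_on_face (j : Fin N) {t₁ t₂ : E3}
    (ht₁ : ‖t₁‖ = 1) (ht₂ : ‖t₂‖ = 1) (ht₁₂ : dot3 t₁ t₂ = 0)
    (ht₁n : dot3 t₁ (P.normal j) = 0) (ht₂n : dot3 t₂ (P.normal j) = 0)
    {k : ℕ} {f : E3 → ℝ} (hf : PolyFun k f)
    (h : ∀ᵐ x ∂(μH[(2 : ℝ)]).restrict (P.face j), f x = 0) {y : E3}
    (hy : dot3 (y - P.basept j) (P.normal j) = 0) : f y = 0 := by
  by_contra hfy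
  rw [← P.planeMap_dot3 j ht₁ ht₂ ht₁₂ ht₁n ht₂n hy] at hfy
  have hnull := hausdorffMeasure_planeMap_image_eq_zero (P.basept j) t₁ t₂
    (hf.volume_planeMap_zero_set _ _ _ hfy)
  have h0 : ∀ᵐ x ∂(μH[(2 : ℝ)]).restrict (P.face j), x ∉ P.face j := by
    filter_upwards [h, ae_restrict_of_ae (measure_eq_zero_iff_ae_notMem.1 hnull)]
      with x hx hx' hxf
    have hpx := P.planeMap_dot3 j ht₁ ht₂ ht₁₂ ht₁n ht₂n (P.face_planar j x hxf)
    exact hx' ⟨_, by rw [Set.mem_ofPred_eq, hpx, hx], hpx⟩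
  rw [ae_restrict_iff' (P.face_isCompact j).measurableSet] at h0
  refine (P.face_pos j).ne' (measure_eq_zero_iff_ae_notMem.2 ?_)
  filter_upwards [h0] with x hx hxf using hx hxf hxf

theorem exists_integral_bubbleExtension_le (j : Fin N) {t₁ t₂ : E3}
    (ht₁ : ‖t₁‖ = 1) (ht₂ : ‖t₂‖ = 1) (ht₁₂ : dot3 t₁ t₂ = 0)
    (ht₁n : dot3 t₁ (P.normal j) = 0) (ht₂n : dot3 t₂ (P.normal j) = 0)
    (k : ℕ) :
    ∃ C : ℝ, ∀ w : E3 → E3, PolyVec k w →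
      ∫ x in P.carrier, ‖(P.lfun j x * P.faceBubble j x) • w (P.faceProj j x)‖ ^ 2 ≤
        C * ∫ x in P.face j, ‖w x‖ ^ 2 ∂(μH[(2 : ℝ)]) := by
  obtain ⟨C, hC⟩ := exists_integral_norm_sq_le (μ := volume.restrict P.carrier)
    (ν := (μH[(2 : ℝ)]).restrict (P.face j))
    (P.bubbleExtension j ∘ₗ polyVecEval k) (polyVecEval k)
    (fun p => memLp_restrict_of_continuous P.carrier_isBounded.measure_lt_top.ne
      P.carrier_isOpen.measurableSet P.carrier_isBounded.isCompact_closure subset_closure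
      (P.continuous_bubbleExtension j (polyVec_polyVecEval k p).continuous) 2)
    (fun p => memLp_restrict_of_continuous
      (P.hausdorffMeasure_face_ne_top j ht₁ ht₂ ht₁₂ ht₁n ht₂n)
      (P.face_isCompact j).measurableSet (P.face_isCompact j) subset_rfl
      (polyVec_polyVecEval k p).continuous 2)
    (fun p hp => by
      refine Filter.Eventually.of_forall fun x => ?_
      have hz : polyVecEval k p (P.faceProj j x) = 0 := by
        ext c
        refine P.eq_zero_of_ae_eq_zero_on_face j ht₁ ht₂ ht₁₂ ht₁n ht₂n
          (polyVec_polyVecEval k p c) ?_ (P.dot3_faceProj_sub j x)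
        filter_upwards [hp] with y hy
        simp [hy]
      simp [bubbleExtension, hz])
  refine ⟨C, fun w hw => ?_⟩
  obtain ⟨p, rfl⟩ := hw.exists_polyVecEval
  exact hC p

end PolyhedralElement

/-- for `q(X) = ((v_b − v₀) × n_j)(π_j(X)) · l_j(X) · φ_{f_j}(X)` one has
`‖q‖²_{L²(T)} ≤ C h_T ∫_{f_j} |(v_b − v₀) × n_j|² dS`, with `C` depending only on the
element and `k`. -/
theorem statement10 {N : ℕ} (P : PolyhedralElement N) (j : Fin N) (k : ℕ)
    (t₁ t₂ : E3) (ht₁ : ‖t₁‖ = 1) (ht₂ : ‖t₂‖ = 1) (ht₁₂ : dot3 t₁ t₂ = 0)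
    (ht₁n : dot3 t₁ (P.normal j) = 0) (ht₂n : dot3 t₂ (P.normal j) = 0) :
    ∃ C : ℝ, ∀ v₀ : E3 → E3, PolyVec k v₀ →
      ∀ v₁ v₂ : E3 → ℝ, PolyFun k v₁ → PolyFun k v₂ →
      (∫ x in P.carrier,
        ‖(P.lfun j x * P.faceBubble j x) •
          cross3 ((v₁ (P.faceProj j x) • t₁ + v₂ (P.faceProj j x) • t₂)
            - v₀ (P.faceProj j x)) (P.normal j)‖ ^ 2) ≤
      C * P.hT * ∫ x in P.face j,
        ‖cross3 ((v₁ x • t₁ + v₂ x • t₂) - v₀ x) (P.normal j)‖ ^ 2 ∂(μH[(2 : ℝ)]) := by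
  obtain ⟨C, hC⟩ := P.exists_integral_bubbleExtension_le j ht₁ ht₂ ht₁₂ ht₁n ht₂n k
  refine ⟨C / P.hT, fun v₀ hv₀ v₁ v₂ hv₁ hv₂ => ?_⟩
  rw [div_mul_cancel₀ C P.hT_pos.ne']
  have hw : PolyVec k fun x => (v₁ x • t₁ + v₂ x • t₂) - v₀ x := fun c => by
    convert ((hv₁.const_mul (t₁ c)).add (hv₂.const_mul (t₂ c))).add ((hv₀ c).const_mul (-1))
      using 2
    simp only [PiLp.sub_apply, PiLp.add_apply, PiLp.smul_apply, smul_eq_mul]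
    ring
  simpa only using hC _ (hw.cross3_const (P.normal j))

end
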